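/- arXiv:1112.1757 — 3 statements merged into one kernel-verified Lean document; each statement's English description precedes it below -/
import Mathlib

section
/- Let A be a real m×n matrix, x̄ ∈ {0,1}ⁿ, b = Ax̄, J₀ = {j : x̄_j = 0} and J₁ = {j : x̄_j = 1}. Then x̄ is the unique optimal solution of the linear program LP(A,b): minimize eᵀx subject to Ax = b and 0 ≤ x ≤ 1, if and only if there exists no z ∈ ℝⁿ with z ≠ 0, Az = 0, z_j ≥ 0 for all j ∈ J₀, z_j ≤ 0 for all j ∈ J₁, and eᵀz ≤ 0. -/
open Matrix Finset

/-- Feasibility for the LP `min eᵀx s.t. Ax = b, 0 ≤ x ≤ 1`. -/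
def LPFeasible {m n : ℕ} (A : Matrix (Fin m) (Fin n) ℝ) (b : Fin m → ℝ)
    (x : Fin n → ℝ) : Prop :=
  A.mulVec x = b ∧ ∀ j, 0 ≤ x j ∧ x j ≤ 1

/-- Optimality for the LP `min eᵀx s.t. Ax = b, 0 ≤ x ≤ 1`. -/
def LPOptimal {m n : ℕ} (A : Matrix (Fin m) (Fin n) ℝ) (b : Fin m → ℝ)
    (x : Fin n → ℝ) : Prop :=
  LPFeasible A b x ∧ ∀ y, LPFeasible A b y → ∑ j, x j ≤ ∑ j, y j

/-- `x` is the unique optimal solution of `min eᵀx s.t. Ax = b, 0 ≤ x ≤ 1`. -/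
def LPUniqueOptimal {m n : ℕ} (A : Matrix (Fin m) (Fin n) ℝ) (b : Fin m → ℝ)
    (x : Fin n → ℝ) : Prop :=
  LPOptimal A b x ∧ ∀ y, LPOptimal A b y → y = x

/-- A direction `z` pointing into the unit box at a binary point stays in the box after moving
by `t * z` for some `t > 0`. -/
theorem exists_pos_step_mem_unit_box {n : ℕ} {x z : Fin n → ℝ}
    (hbin : ∀ j, x j = 0 ∨ x j = 1) (h₀ : ∀ j, x j = 0 → 0 ≤ z j)
    (h₁ : ∀ j, x j = 1 → z j ≤ 0) :
    ∃ t : ℝ, 0 < t ∧ ∀ j, 0 ≤ (x + t • z) j ∧ (x + t • z) j ≤ 1 := by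
  have hpos : 0 < 1 + ‖z‖ := by positivity
  refine ⟨(1 + ‖z‖)⁻¹, inv_pos.mpr hpos, fun j => ?_⟩
  have hz : |(1 + ‖z‖)⁻¹ * z j| ≤ 1 := by
    rw [abs_mul, abs_of_pos (inv_pos.mpr hpos), inv_mul_le_one₀ hpos]
    have : |z j| ≤ ‖z‖ := norm_le_pi_norm z j
    linarith
  obtain ⟨hl, hu⟩ := abs_le.mp hz
  simp only [Pi.add_apply, Pi.smul_apply, smul_eq_mul]
  rcases hbin j with h | h
  · have := mul_nonneg (inv_pos.mpr hpos).le (h₀ j h)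
    constructor <;> linarith
  · have := mul_nonpos_of_nonneg_of_nonpos (inv_pos.mpr hpos).le (h₁ j h)
    constructor <;> linarith

/-- A binary vector `x̄` with `b = Ax̄` is the unique optimal solution of the LP
`min eᵀx s.t. Ax = b, 0 ≤ x ≤ 1` iff there is no `z ≠ 0` with `Az = 0`,
`z_j ≥ 0` on `J₀ = {j : x̄ j = 0}`, `z_j ≤ 0` on `J₁ = {j : x̄ j = 1}`, and `eᵀz ≤ 0`. -/
theorem unique_recovery_iff_no_z {m n : ℕ}
    (A : Matrix (Fin m) (Fin n) ℝ) (xbar : Fin n → ℝ)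
    (hbin : ∀ j, xbar j = 0 ∨ xbar j = 1)
    (b : Fin m → ℝ) (hb : b = A.mulVec xbar) :
    LPUniqueOptimal A b xbar ↔
      ¬ ∃ z : Fin n → ℝ, z ≠ 0 ∧ A.mulVec z = 0 ∧
        (∀ j, xbar j = 0 → 0 ≤ z j) ∧ (∀ j, xbar j = 1 → z j ≤ 0) ∧
        ∑ j, z j ≤ 0 := by
  subst hb
  constructor
  · rintro ⟨⟨-, hmin⟩, huniq⟩ ⟨z, hz, hAz, h₀, h₁, hsum⟩
    obtain ⟨t, ht, hbox⟩ := exists_pos_step_mem_unit_box hbin h₀ h₁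
    have hfeas : LPFeasible A (A.mulVec xbar) (xbar + t • z) :=
      ⟨by rw [mulVec_add, mulVec_smul, hAz, smul_zero, add_zero], hbox⟩
    have hle : ∑ j, (xbar + t • z) j ≤ ∑ j, xbar j := by
      simp only [Pi.add_apply, Pi.smul_apply, smul_eq_mul, sum_add_distrib, ← mul_sum]
      linarith [mul_nonpos_of_nonneg_of_nonpos ht.le hsum]
    have heq := huniq _ ⟨hfeas, fun y hy => hle.trans (hmin y hy)⟩
    exact hz ((smul_eq_zero.mp (add_eq_left.mp heq)).resolve_left ht.ne')
  · intro hno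
    have hlt : ∀ y, LPFeasible A (A.mulVec xbar) y → y ≠ xbar →
        ∑ j, xbar j < ∑ j, y j := by
      rintro y ⟨hAy, hbox⟩ hne
      by_contra! hle
      refine hno ⟨y - xbar, sub_ne_zero.mpr hne, by rw [mulVec_sub, hAy, sub_self],
        fun j hj => ?_, fun j hj => ?_, ?_⟩
      · simpa [hj] using (hbox j).1
      · simpa [hj] using (hbox j).2
      · simpa [sum_sub_distrib] using hle
    have hfeas : LPFeasible A (A.mulVec xbar) xbar :=
      ⟨rfl, fun j => by rcases hbin j with h | h <;> simp [h]⟩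
    refine ⟨⟨hfeas, fun y hy => ?_⟩, fun y hy => ?_⟩
    · by_cases h : y = xbar
      · rw [h]
      · exact (hlt y hy h).le
    · by_contra h
      exact (hlt y hy.1 h).not_ge (hy.2 xbar hfeas)
end

section
/- Let A be a real m×n matrix, let x̄ ∈ {0,1}ⁿ have exactly k entries equal to 1, let b = Ax̄, J₀ = {j : x̄_j = 0}, J₁ = {j : x̄_j = 1}, Q₀ = {A_j : j ∈ J₀} and Q₁ = {A_j : j ∈ J₁}, where A_j denotes the j-th column of A viewed as a point of ℝᵐ. Then x̄ is the unique optimal solution of the linear program LP(A,b): minimize eᵀx subject to Ax = b and 0 ≤ x ≤ 1, if and only if the convex hull of Q₀ ∪ {0} and the convex hull of Q₁ are disjoint. -/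
open Matrix Finset

/-- The convex hull of finitely many indexed points consists of their convex combinations. -/
theorem mem_convexHull_image_iff {ι E : Type*} [Fintype ι] [AddCommGroup E] [Module ℝ E]
    (f : ι → E) (S : Set ι) (x : E) :
    x ∈ convexHull ℝ (f '' S) ↔
      ∃ w : ι → ℝ, (∀ i, 0 ≤ w i) ∧ (∀ i, i ∉ S → w i = 0) ∧ ∑ i, w i = 1 ∧
        ∑ i, w i • f i = x := by
  classical
  constructor
  · intro hx
    refine convexHull_min (t := {x | ∃ w : ι → ℝ, (∀ i, 0 ≤ w i) ∧ (∀ i, i ∉ S → w i = 0) ∧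
      ∑ i, w i = 1 ∧ ∑ i, w i • f i = x}) ?_ ?_ hx
    · rintro _ ⟨i, hi, rfl⟩
      refine ⟨Pi.single i 1, fun j => ?_, fun j hj => ?_, by simp, ?_⟩
      · by_cases h : j = i
        · subst h; simp
        · simp [h]
      · exact Pi.single_eq_of_ne (fun h : j = i => hj (h ▸ hi)) 1
      · simp [Pi.single_apply, ite_smul]
    · rintro _ ⟨v, hv, hvS, hv1, rfl⟩ _ ⟨w, hw, hwS, hw1, rfl⟩ a c ha hc hac
      refine ⟨fun i => a * v i + c * w i, fun i => ?_, fun i hi => ?_, ?_, ?_⟩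
      · have := hv i
        have := hw i
        positivity
      · simp [hvS i hi, hwS i hi]
      · rw [Finset.sum_add_distrib, ← Finset.mul_sum, ← Finset.mul_sum, hv1, hw1]
        simpa using hac
      · simp only [add_smul, mul_smul, Finset.sum_add_distrib, Finset.smul_sum]
  · rintro ⟨w, hw, hwS, hw1, rfl⟩
    have hsub : ∀ i ∈ (Finset.univ : Finset ι), i ∉ Finset.univ.filter (· ∈ S) → w i = 0 :=
      fun i _ hi => hwS i (by simpa using hi)
    rw [← Finset.sum_subset (Finset.filter_subset (· ∈ S) Finset.univ)
      fun i hi hi' => by rw [hsub i hi hi', zero_smul]]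
    refine (convex_convexHull ℝ _).sum_mem (fun i _ => hw i) ?_ fun i hi =>
      subset_convexHull ℝ _ ⟨i, by simpa using hi, rfl⟩
    rwa [Finset.sum_subset (Finset.filter_subset _ _) hsub]

/-- Adjoining the origin relaxes the weights from total mass one to total mass at most one. -/
theorem mem_convexHull_image_union_zero_iff {ι E : Type*} [Fintype ι] [AddCommGroup E]
    [Module ℝ E] (f : ι → E) (S : Set ι) (x : E) :
    x ∈ convexHull ℝ (f '' S ∪ {0}) ↔
      ∃ w : ι → ℝ, (∀ i, 0 ≤ w i) ∧ (∀ i, i ∉ S → w i = 0) ∧ ∑ i, w i ≤ 1 ∧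
        ∑ i, w i • f i = x := by
  have himage : f '' S ∪ {0} =
      (fun o : Option ι => o.elim 0 f) '' (insert none (some '' S)) := by
    rw [Set.image_insert_eq, Set.image_image, Set.union_singleton]
    rfl
  rw [himage, mem_convexHull_image_iff]
  constructor
  · rintro ⟨w, hw, hwS, hw1, rfl⟩
    rw [Fintype.sum_option] at hw1
    refine ⟨fun i => w (some i), fun i => hw _, fun i hi => hwS _ (by simpa using hi), ?_, ?_⟩
    · linarith [hw none]
    · simp [Fintype.sum_option]
  · rintro ⟨w, hw, hwS, hw1, rfl⟩
    refine ⟨fun o => o.elim (1 - ∑ i, w i) w, ?_, ?_, ?_, ?_⟩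
    · rintro (_ | i)
      · simpa using hw1
      · exact hw i
    · rintro (_ | i) hi
      · simp at hi
      · exact hwS i (by simpa using hi)
    · simp [Fintype.sum_option]
    · simp [Fintype.sum_option]

/-- A feasible point is the unique optimum iff no other feasible point does as well. -/
theorem lpUniqueOptimal_iff {m n : ℕ} {A : Matrix (Fin m) (Fin n) ℝ} {b : Fin m → ℝ}
    {x : Fin n → ℝ} (hx : LPFeasible A b x) :
    LPUniqueOptimal A b x ↔ ∀ y, LPFeasible A b y → ∑ j, y j ≤ ∑ j, x j → y = x := by
  constructor
  · rintro ⟨hopt, huniq⟩ y hy hle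
    exact huniq y ⟨hy, fun z hz => hle.trans (hopt.2 z hz)⟩
  · intro h
    refine ⟨⟨hx, fun y hy => ?_⟩, fun y hy => h y hy.1 (hy.2 x hx)⟩
    by_contra! hlt
    exact hlt.ne (by rw [h y hy hlt.le])

/-- A binary `k`-sparse `x̄` with `b = Ax̄` is the unique optimal solution of
`min eᵀx s.t. Ax = b, 0 ≤ x ≤ 1` iff the convex hull of the columns
`Q₀ = {A_j : x̄ j = 0}` together with the origin is disjoint from the convex hull
of the columns `Q₁ = {A_j : x̄ j = 1}`. -/
theorem unique_recovery_iff_hulls_disjoint {m n k : ℕ}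
    (A : Matrix (Fin m) (Fin n) ℝ) (xbar : Fin n → ℝ)
    (hbin : ∀ j, xbar j = 0 ∨ xbar j = 1)
    (hk : (Finset.univ.filter fun j => xbar j = 1).card = k)
    (b : Fin m → ℝ) (hb : b = A.mulVec xbar) :
    LPUniqueOptimal A b xbar ↔
      Disjoint
        (convexHull ℝ ((Aᵀ '' {j | xbar j = 0}) ∪ {0}))
        (convexHull ℝ (Aᵀ '' {j | xbar j = 1})) := by
  have hfeas : LPFeasible A b xbar :=
    ⟨hb.symm, fun j => by rcases hbin j with h | h <;> simp [h]⟩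
  have hmul : ∀ w : Fin n → ℝ, ∑ j, w j • Aᵀ j = A *ᵥ w := fun w => by
    simp [Matrix.mulVec_eq_sum]
  have hull_zero := mem_convexHull_image_union_zero_iff (fun j => Aᵀ j) {j | xbar j = 0}
  have hull_one := mem_convexHull_image_iff (fun j => Aᵀ j) {j | xbar j = 1}
  simp only [hmul] at hull_zero hull_one
  refine (lpUniqueOptimal_iff hfeas).trans (Iff.trans ?_ (Set.disjoint_left.trans
    (forall_congr' fun p => imp_congr (hull_zero p) (not_congr (hull_one p)))).symm)
  constructor
  · rintro h p ⟨u, hu, huS, hu1, rfl⟩ ⟨v, hv, hvS, hv1, hvu⟩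
    have hule : ∀ j, u j ≤ 1 := fun j =>
      (Finset.single_le_sum (fun i _ => hu i) (Finset.mem_univ j)).trans hu1
    have hvle : ∀ j, v j ≤ 1 := fun j =>
      (Finset.single_le_sum (fun i _ => hv i) (Finset.mem_univ j)).trans hv1.le
    have key := h (xbar + (u - v)) ⟨by
      rw [Matrix.mulVec_add, Matrix.mulVec_sub, hvu, sub_self, add_zero, hb], fun j => by
        simp only [Pi.add_apply, Pi.sub_apply]
        rcases hbin j with hj | hj
        · rw [hvS j (by simp [hj]), hj]
          simpa using ⟨hu j, hule j⟩
        · rw [huS j (by simp [hj]), hj]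
          constructor <;> linarith [hv j, hvle j]⟩ (by
      simp only [Pi.add_apply, Pi.sub_apply, Finset.sum_add_distrib, Finset.sum_sub_distrib]
      linarith)
    have huv : u = v := sub_eq_zero.mp (add_eq_left.mp key)
    have hv0 : ∀ j, v j = 0 := fun j => by
      rcases hbin j with hj | hj
      · exact hvS j (by simp [hj])
      · rw [← huv]
        exact huS j (by simp [hj])
    simp [hv0] at hv1
  · intro h y hy hle
    by_contra hne
    set u : Fin n → ℝ := fun j => if xbar j = 0 then y j else 0 with hu
    set v : Fin n → ℝ := fun j => if xbar j = 0 then 0 else 1 - y j with hv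
    have hu0 : ∀ j, 0 ≤ u j := fun j => by
      simp only [hu]
      split_ifs
      exacts [(hy.2 j).1, le_rfl]
    have hv0 : ∀ j, 0 ≤ v j := fun j => by
      simp only [hv]
      split_ifs
      exacts [le_rfl, sub_nonneg.mpr (hy.2 j).2]
    have huv : y = xbar + (u - v) := by
      ext j
      rcases hbin j with hj | hj <;> simp [hu, hv, hj]
    have hsum : ∑ j, u j ≤ ∑ j, v j := by
      rw [huv] at hle
      simp only [Pi.add_apply, Pi.sub_apply, Finset.sum_add_distrib,
        Finset.sum_sub_distrib] at hle
      linarith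
    have hA : A *ᵥ u = A *ᵥ v := by
      have := hy.1
      rwa [huv, Matrix.mulVec_add, Matrix.mulVec_sub, ← hb, add_eq_left, sub_eq_zero] at this
    have hpos : 0 < ∑ j, v j := by
      refine (Finset.sum_nonneg fun j _ => hv0 j).lt_of_ne fun hzero => hne ?_
      have hvz : ∀ j, v j = 0 := fun j =>
        (Finset.sum_eq_zero_iff_of_nonneg fun i _ => hv0 i).mp hzero.symm j (Finset.mem_univ j)
      have huz : ∀ j, u j = 0 := fun j =>
        (Finset.sum_eq_zero_iff_of_nonneg fun i _ => hu0 i).mp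
          (le_antisymm (hzero ▸ hsum) (Finset.sum_nonneg fun i _ => hu0 i)) j (Finset.mem_univ j)
      rw [huv]
      ext j
      simp [huz, hvz]
    have hinv := (inv_pos.mpr hpos).le
    refine h (a := A *ᵥ ((∑ j, v j)⁻¹ • u))
      ⟨_, fun j => mul_nonneg hinv (hu0 j), fun j hj => by simp [hu, show xbar j ≠ 0 from hj], ?_, rfl⟩
      ⟨(∑ j, v j)⁻¹ • v, fun j => mul_nonneg hinv (hv0 j), fun j hj => ?_, ?_, ?_⟩
    · rw [← Finset.mul_sum, inv_mul_le_iff₀ hpos, mul_one]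
      exact hsum
    · simp [hv, (hbin j).resolve_right hj]
    · simp only [Pi.smul_apply, smul_eq_mul, ← Finset.mul_sum]
      exact inv_mul_cancel₀ hpos.ne'
    · rw [Matrix.mulVec_smul, Matrix.mulVec_smul, hA]
end

section
/- Let A be a real m×n matrix, let x̄ ∈ {0,1}ⁿ have exactly k entries equal to 1, let b = Ax̄, J₀ = {j : x̄_j = 0} and J₁ = {j : x̄_j = 1}, and let A_j denote the j-th column of A viewed as a point of ℝᵐ. Then x̄ is the unique optimal solution of the linear program LP(A,b): minimize eᵀx subject to Ax = b and 0 ≤ x ≤ 1, if and only if there exist a ∈ ℝᵐ and c ∈ ℝ with c > 0 such that ⟨a, A_j⟩ < c for all j ∈ J₀ and ⟨a, A_j⟩ > c for all j ∈ J₁; that is, the hyperplane {x ∈ ℝᵐ : ⟨a,x⟩ = c}, which does not pass through the origin, strictly separates the points {A_j : j ∈ J₀} together with the origin from the points {A_j : j ∈ J₁}. -/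
open Matrix Finset

/-- **Gordan's theorem**: if no nontrivial nonnegative combination of finitely many vectors
vanishes, then some linear functional is positive on all of them. -/
theorem exists_forall_pos_of_nonneg_combination_trivial {ι E : Type*} [Fintype ι]
    [AddCommGroup E] [Module ℝ E] [TopologicalSpace E] [IsTopologicalAddGroup E]
    [ContinuousSMul ℝ E] [LocallyConvexSpace ℝ E] [T2Space E] (v : ι → E)
    (hv : ∀ w : ι → ℝ, (∀ i, 0 ≤ w i) → ∑ i, w i • v i = 0 → w = 0) :
    ∃ f : E →L[ℝ] ℝ, ∀ i, 0 < f (v i) := by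
  classical
  set L : (ι → ℝ) →ₗ[ℝ] E := Fintype.linearCombination ℝ v with hL
  have hcont : Continuous L := L.continuous_of_finiteDimensional
  have hclosed : IsClosed (L '' stdSimplex ℝ ι) :=
    ((isCompact_stdSimplex ℝ ι).image hcont).isClosed
  have hconv : Convex ℝ (L '' stdSimplex ℝ ι) := (convex_stdSimplex ℝ ι).linear_image L
  have hzero : (0 : E) ∉ L '' stdSimplex ℝ ι := by
    rintro ⟨w, ⟨hw, hsum⟩, hLw⟩
    have hw0 := hv w hw (by simpa [hL, Fintype.linearCombination_apply] using hLw)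
    simp [hw0] at hsum
  obtain ⟨f, u, hu, hf⟩ := geometric_hahn_banach_point_closed hconv hclosed hzero
  refine ⟨f, fun i => ?_⟩
  have hi := hf (v i) ⟨Pi.single i 1, single_mem_stdSimplex ℝ i, by
    simp [hL]⟩
  rw [map_zero] at hu
  exact hu.trans hi

/-- A continuous linear functional on `ℝᵐ × ℝ` in coordinates. -/
theorem ContinuousLinearMap.apply_pi_prod_eq_dotProduct {m : ℕ}
    (f : ((Fin m → ℝ) × ℝ) →L[ℝ] ℝ) (x : Fin m → ℝ) (t : ℝ) :
    f (x, t) = (fun i => f (Pi.single i 1, 0)) ⬝ᵥ x + t * f (0, 1) := by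
  have hx : (x, t) = ∑ i, x i • ((Pi.single i 1, 0) : (Fin m → ℝ) × ℝ) + t • (0, 1) := by
    ext i
    · simp [Prod.fst_sum, Finset.sum_apply, Pi.single_apply]
    · simp [Prod.snd_sum]
  rw [hx, map_add, map_sum, map_smul]
  simp only [map_smul, smul_eq_mul, dotProduct, mul_comm]

/-- If a hyperplane `⟨a, x⟩ = c` with `c > 0` separates the columns according to the values of a
binary point, then this point is the unique optimal solution. -/
theorem LPUniqueOptimal.of_separating_hyperplane {m n : ℕ} {A : Matrix (Fin m) (Fin n) ℝ}
    {x : Fin n → ℝ} (hbin : ∀ j, x j = 0 ∨ x j = 1) {a : Fin m → ℝ} {c : ℝ} (hc : 0 < c)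
    (h0 : ∀ j, x j = 0 → a ⬝ᵥ Aᵀ j < c) (h1 : ∀ j, x j = 1 → c < a ⬝ᵥ Aᵀ j) :
    LPUniqueOptimal A (A.mulVec x) x := by
  have hfeas : LPFeasible A (A.mulVec x) x :=
    ⟨rfl, fun j => by rcases hbin j with h | h <;> simp [h]⟩
  have hterm : ∀ y, LPFeasible A (A.mulVec x) y →
      ∀ j, 0 ≤ (c - a ⬝ᵥ Aᵀ j) * (y j - x j) := by
    intro y hy j
    obtain ⟨hl, hr⟩ := hy.2 j
    rcases hbin j with h | h
    · exact mul_nonneg (by linarith [h0 j h]) (by linarith)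
    · exact mul_nonneg_of_nonpos_of_nonpos (by linarith [h1 j h]) (by linarith)
  have hsum : ∀ y, LPFeasible A (A.mulVec x) y →
      ∑ j, (c - a ⬝ᵥ Aᵀ j) * (y j - x j) = c * (∑ j, y j - ∑ j, x j) := by
    intro y hy
    have hker : ∑ j, (a ⬝ᵥ Aᵀ j) * (y j - x j) = 0 := by
      have h : a ⬝ᵥ A.mulVec (y - x) = 0 := by rw [mulVec_sub, hy.1, sub_self, dotProduct_zero]
      rw [dotProduct_mulVec] at h
      exact h
    simp only [sub_mul, Finset.sum_sub_distrib, hker, sub_zero, ← Finset.mul_sum]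
  refine ⟨⟨hfeas, fun y hy => ?_⟩, fun y hy => ?_⟩
  · have h := Finset.sum_nonneg fun j (_ : j ∈ Finset.univ) => hterm y hy j
    rw [hsum y hy] at h
    linarith [nonneg_of_mul_nonneg_right h hc]
  · have hle := hy.2 x hfeas
    have h := Finset.sum_nonneg fun j (_ : j ∈ Finset.univ) => hterm y hy.1 j
    have hs := hsum y hy.1
    have hz : ∑ j, (c - a ⬝ᵥ Aᵀ j) * (y j - x j) = 0 :=
      le_antisymm (hs ▸ mul_nonpos_of_nonneg_of_nonpos hc.le (by linarith)) h
    rw [Finset.sum_eq_zero_iff_of_nonneg fun j _ => hterm y hy.1 j] at hz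
    ext j
    rcases mul_eq_zero.mp (hz j (Finset.mem_univ j)) with hj | hj
    · rcases hbin j with hx | hx
      · linarith [h0 j hx]
      · linarith [h1 j hx]
    · linarith

/-- A unique binary optimal solution admits no nonzero feasible direction along which the
objective does not increase. -/
theorem LPUniqueOptimal.eq_zero_of_descent {m n : ℕ} {A : Matrix (Fin m) (Fin n) ℝ}
    {x : Fin n → ℝ} (hbin : ∀ j, x j = 0 ∨ x j = 1) (hx : LPUniqueOptimal A (A.mulVec x) x)
    {w : Fin n → ℝ} (hw : ∀ j, 0 ≤ w j)
    (hker : A.mulVec (fun j => w j * (1 - 2 * x j)) = 0)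
    (hdesc : ∑ j, w j * (1 - 2 * x j) ≤ 0) : w = 0 := by
  set d : Fin n → ℝ := fun j => w j * (1 - 2 * x j) with hd
  have hpos : 0 < 1 + ∑ j, w j := by linarith [Finset.sum_nonneg fun j (_ : j ∈ univ) => hw j]
  set ε : ℝ := (1 + ∑ j, w j)⁻¹ with hε
  have hεpos : 0 < ε := inv_pos.mpr hpos
  have hεw : ∀ j, ε * w j ≤ 1 := by
    intro j
    rw [hε, inv_mul_le_one₀ hpos]
    linarith [Finset.single_le_sum (fun i _ => hw i) (Finset.mem_univ j)]
  have hfeas : LPFeasible A (A.mulVec x) (x + ε • d) := by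
    refine ⟨by rw [mulVec_add, mulVec_smul, hker, smul_zero, add_zero], fun j => ?_⟩
    have hnn := mul_nonneg hεpos.le (hw j)
    have hle := hεw j
    rcases hbin j with h | h <;> simp only [Pi.add_apply, Pi.smul_apply, smul_eq_mul, hd, h] <;>
      constructor <;> linarith
  have hsum : ∑ j, (x + ε • d) j ≤ ∑ j, x j := by
    simp only [Pi.add_apply, Pi.smul_apply, smul_eq_mul, Finset.sum_add_distrib, ← Finset.mul_sum]
    linarith [mul_nonpos_of_nonneg_of_nonpos hεpos.le hdesc]
  have heq := hx.2 _ ⟨hfeas, fun y hy => hsum.trans (hx.1.2 y hy)⟩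
  ext j
  have hj : ε * (w j * (1 - 2 * x j)) = 0 := by simpa [hd] using congrFun heq j
  have hwj := (mul_eq_zero.mp hj).resolve_left hεpos.ne'
  rcases hbin j with h | h <;> rw [h] at hwj <;> simp only [Pi.zero_apply] <;> linarith

/-- A unique binary optimal solution yields a hyperplane `⟨a, x⟩ = c` with `c > 0` separating the
columns according to the values of that solution. -/
theorem LPUniqueOptimal.exists_separating_hyperplane {m n : ℕ} {A : Matrix (Fin m) (Fin n) ℝ}
    {x : Fin n → ℝ} (hbin : ∀ j, x j = 0 ∨ x j = 1) (hx : LPUniqueOptimal A (A.mulVec x) x) :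
    ∃ (a : Fin m → ℝ) (c : ℝ), 0 < c ∧
      (∀ j, x j = 0 → a ⬝ᵥ Aᵀ j < c) ∧ (∀ j, x j = 1 → c < a ⬝ᵥ Aᵀ j) := by
  let v : Option (Fin n) → (Fin m → ℝ) × ℝ := fun o =>
    o.elim (0, 1) fun j => (1 - 2 * x j) • (Aᵀ j, 1)
  obtain ⟨f, hf⟩ := exists_forall_pos_of_nonneg_combination_trivial v fun w hw hcomb => by
    rw [Fintype.sum_option] at hcomb
    have hker : A.mulVec (fun j => w (some j) * (1 - 2 * x j)) = 0 := by
      ext i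
      have hi := congrFun (congrArg Prod.fst hcomb) i
      simp only [v, Option.elim, Prod.fst_add, Prod.fst_sum, Prod.smul_fst, Pi.add_apply,
        Finset.sum_apply, Pi.smul_apply, smul_eq_mul, Prod.fst_zero, Pi.zero_apply, mul_zero,
        zero_add, transpose_apply] at hi
      simp only [mulVec, dotProduct, Pi.zero_apply]
      rw [← hi]
      exact Finset.sum_congr rfl fun j _ => by ring
    have hlast : w none + ∑ j, w (some j) * (1 - 2 * x j) = 0 := by
      simpa [v, Prod.snd_sum] using congrArg Prod.snd hcomb
    have hsome : (fun j => w (some j)) = 0 :=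
      hx.eq_zero_of_descent hbin (fun j => hw _) hker (by linarith [hw none])
    have hsome' : ∀ j, w (some j) = 0 := congrFun hsome
    ext o
    cases o with
    | none => simpa [hsome'] using hlast
    | some j => exact hsome' j
  have hcol : ∀ j, 0 < (1 - 2 * x j) * ((fun i => f (Pi.single i 1, 0)) ⬝ᵥ Aᵀ j + f (0, 1)) := by
    intro j
    have hj := hf (some j)
    simp only [v, Option.elim, map_smul, smul_eq_mul] at hj
    rwa [f.apply_pi_prod_eq_dotProduct, one_mul] at hj
  refine ⟨-fun i => f (Pi.single i 1, 0), f (0, 1), hf none, fun j h => ?_, fun j h => ?_⟩ <;>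
  · have hj := hcol j
    rw [h] at hj
    rw [neg_dotProduct]
    linarith

/-- A binary `k`-sparse `x̄` with `b = Ax̄` is the unique optimal solution of
`min eᵀx s.t. Ax = b, 0 ≤ x ≤ 1` iff there is a hyperplane `{x : ⟨a,x⟩ = c}`
with `c > 0` (hence not through the origin) strictly separating the columns
`{A_j : x̄ j = 0}` (together with the origin) from `{A_j : x̄ j = 1}`. -/
theorem unique_recovery_iff_separating_hyperplane {m n k : ℕ}
    (A : Matrix (Fin m) (Fin n) ℝ) (xbar : Fin n → ℝ)
    (hbin : ∀ j, xbar j = 0 ∨ xbar j = 1)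
    (hk : (Finset.univ.filter fun j => xbar j = 1).card = k)
    (b : Fin m → ℝ) (hb : b = A.mulVec xbar) :
    LPUniqueOptimal A b xbar ↔
      ∃ (a : Fin m → ℝ) (c : ℝ), 0 < c ∧
        (∀ j, xbar j = 0 → a ⬝ᵥ Aᵀ j < c) ∧
        (∀ j, xbar j = 1 → c < a ⬝ᵥ Aᵀ j) := by
  subst hb
  refine ⟨fun h => h.exists_separating_hyperplane hbin, ?_⟩
  rintro ⟨a, c, hc, h0, h1⟩
  exact LPUniqueOptimal.of_separating_hyperplane hbin hc h0 h1
end
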